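/- For every n ∈ ℕ, every A ∈ σ(𝒜ⁿ) with μ(A) > 0, and every real t > 0 one has ℙ_A(τ_A ≤ t) ≤ 2n(δ_A(n) + δ_A(r_A)) + t·μ(A) + ᾱ(n). -/

import Mathlib

open MeasureTheory Filter Set

/-- `A` is an `n`-cylinder for the map `T` and the partition `𝒜`:
an element of the join `⋁_{j=0}^{n-1} T^{-j}𝒜`. -/
def IsCylinder {Ω : Type*} (T : Ω → Ω) (𝒜 : Set (Set Ω)) (n : ℕ) (A : Set Ω) : Prop :=
  ∃ f : ℕ → Set Ω, (∀ j < n, f j ∈ 𝒜) ∧ A = ⋂ j ∈ Finset.range n, T^[j] ⁻¹' f j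

/-- `A` is a countable union of `n`-cylinders, i.e. `A ∈ σ(𝒜ⁿ)`. -/
def IsCylinderUnion {Ω : Type*} (T : Ω → Ω) (𝒜 : Set (Set Ω)) (n : ℕ) (A : Set Ω) : Prop :=
  ∃ 𝒞 : Set (Set Ω), 𝒞.Countable ∧ (∀ C ∈ 𝒞, IsCylinder T 𝒜 n C) ∧ A = ⋃₀ 𝒞

/-- The σ-algebra generated by all cylinders `⋃_ℓ 𝒜^ℓ`. -/
def cylinderSigma {Ω : Type*} (T : Ω → Ω) (𝒜 : Set (Set Ω)) : MeasurableSpace Ω :=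
  MeasurableSpace.generateFrom {S | ∃ ℓ, IsCylinder T 𝒜 ℓ S}

/-- `μ` is α-mixing for `T` with respect to the partition `𝒜`:
`|μ(A ∩ T^{-n-k}B) − μ(A)μ(B)| ≤ α(k) μ(B)` for every union `A` of `n`-cylinders and every
`B` in the σ-algebra generated by all cylinders. -/
def AlphaMixing {Ω : Type*} [MeasurableSpace Ω] (μ : Measure Ω) (T : Ω → Ω)
    (𝒜 : Set (Set Ω)) (α : ℕ → ℝ) : Prop :=
  ∀ n k : ℕ, ∀ A B : Set Ω, IsCylinderUnion T 𝒜 n A →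
    MeasurableSet[cylinderSigma T 𝒜] B →
    |(μ (A ∩ T^[n + k] ⁻¹' B)).toReal - (μ A).toReal * (μ B).toReal| ≤ α k * (μ B).toReal

/-- `A^{(w)}`: the smallest union of `w`-cylinders containing `A`. -/
def cylinderHull {Ω : Type*} (T : Ω → Ω) (𝒜 : Set (Set Ω)) (w : ℕ) (A : Set Ω) : Set Ω :=
  ⋃₀ {C | IsCylinder T 𝒜 w C ∧ (C ∩ A).Nonempty}

/-- `δ_A(k) = min_{1 ≤ w ≤ k} ( μ(A^{(w)}) + α(k−w) )`. -/
noncomputable def deltaA {Ω : Type*} [MeasurableSpace Ω] (μ : Measure Ω) (T : Ω → Ω)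
    (𝒜 : Set (Set Ω)) (α : ℕ → ℝ) (A : Set Ω) (k : ℕ) : ℝ :=
  sInf ((fun w => (μ (cylinderHull T 𝒜 w A)).toReal + α (k - w)) '' Set.Icc 1 k)

/-- `ᾱ(n) = Σ_{j=n}^∞ α(j)`. -/
noncomputable def alphaBar (α : ℕ → ℝ) (n : ℕ) : ℝ := ∑' j : ℕ, α (n + j)

/-- The hitting time `τ_A(x) = inf {k ≥ 1 : T^k x ∈ A}` (with value `⊤` if the orbit
never enters `A`). -/
noncomputable def hitTime {Ω : Type*} (T : Ω → Ω) (A : Set Ω) (x : Ω) : ℕ∞ :=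
  sInf {ℓ : ℕ∞ | ∃ m : ℕ, ℓ = (m : ℕ∞) ∧ 1 ≤ m ∧ T^[m] x ∈ A}

/-- The `k`-th hitting time `τ_A^k`. -/
noncomputable def hitTimeK {Ω : Type*} (T : Ω → Ω) (A : Set Ω) : ℕ → Ω → ℕ∞
  | 0, _ => 0
  | k + 1, x =>
      sInf {ℓ : ℕ∞ | ∃ m : ℕ, ℓ = (m : ℕ∞) ∧ hitTimeK T A k x < (m : ℕ∞) ∧ T^[m] x ∈ A}

/-- The recurrence time `r_A = inf {j ≥ 1 : A ∩ T^{-j}A ≠ ∅}`. -/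
noncomputable def recTime {Ω : Type*} (T : Ω → Ω) (A : Set Ω) : ℕ :=
  sInf {j : ℕ | 1 ≤ j ∧ (A ∩ T^[j] ⁻¹' A).Nonempty}

/-- `W_m(x) = Σ_{j=1}^m 1_A(T^j x)`, the number of visits to `A` up to time `m`. -/
noncomputable def visits {Ω : Type*} (T : Ω → Ω) (A : Set Ω) (m : ℕ) (x : Ω) : ℕ :=
  ∑ j ∈ Finset.Icc 1 m, A.indicator (fun _ => 1) (T^[j] x)

/-- `W_m^i(x) = Σ_{1 ≤ j ≤ m, j ≠ i} 1_A(T^j x)`. -/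
noncomputable def visitsAvoid {Ω : Type*} (T : Ω → Ω) (A : Set Ω) (m i : ℕ) (x : Ω) : ℕ :=
  ∑ j ∈ (Finset.Icc 1 m).erase i, A.indicator (fun _ => 1) (T^[j] x)

lemma aux_countable_cyl {Ω : Type*} (T : Ω → Ω) (𝒜 : Set (Set Ω)) (hcnt : 𝒜.Countable) (w : ℕ) :
    {C | IsCylinder T 𝒜 w C}.Countable := by
  have : Countable 𝒜 := hcnt.to_subtype
  refine (Set.countable_range
    (fun g : Fin w → 𝒜 => ⋂ j : Fin w, T^[(j : ℕ)] ⁻¹' (g j : Set Ω))).mono ?_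
  rintro C ⟨f, hf, rfl⟩
  refine ⟨fun j => ⟨f j, hf j j.2⟩, ?_⟩
  ext x
  simp only [Set.mem_iInter, Finset.mem_range]
  exact ⟨fun h i hi => h ⟨i, hi⟩, fun h i => h i i.2⟩

lemma aux_hull_union {Ω : Type*} (T : Ω → Ω) (𝒜 : Set (Set Ω)) (hcnt : 𝒜.Countable) (w : ℕ)
    (A : Set Ω) : IsCylinderUnion T 𝒜 w (cylinderHull T 𝒜 w A) :=
  ⟨_, (aux_countable_cyl T 𝒜 hcnt w).mono (fun _ h => h.1), fun _ h => h.1, rfl⟩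

lemma aux_subset_hull {Ω : Type*} (T : Ω → Ω) (𝒜 : Set (Set Ω)) (hcov : ⋃₀ 𝒜 = Set.univ) (w : ℕ)
    (A : Set Ω) : A ⊆ cylinderHull T 𝒜 w A := by
  intro x hx
  have h : ∀ j : ℕ, ∃ s ∈ 𝒜, T^[j] x ∈ s := by
    intro j
    have : T^[j] x ∈ ⋃₀ 𝒜 := by rw [hcov]; trivial
    exact this
  choose f hf hfx using h
  have hmem : x ∈ ⋂ j ∈ Finset.range w, T^[j] ⁻¹' f j := by
    simp only [Set.mem_iInter]
    exact fun j _ => hfx j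
  exact ⟨_, ⟨⟨f, fun j _ => hf j, rfl⟩, x, hmem, hx⟩, hmem⟩

lemma aux_meas {Ω : Type*} (T : Ω → Ω) (𝒜 : Set (Set Ω)) (n : ℕ)
    (A : Set Ω) (hA : IsCylinderUnion T 𝒜 n A) : MeasurableSet[cylinderSigma T 𝒜] A := by
  obtain ⟨C, hC, h, rfl⟩ := hA
  exact MeasurableSet.sUnion hC
    (fun c hc => MeasurableSpace.measurableSet_generateFrom ⟨n, h c hc⟩)

lemma aux_hit {Ω : Type*} (T : Ω → Ω) (A : Set Ω) (N : ℕ) :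
    A ∩ {x | hitTime T A x ≤ (N : ℕ∞)} ⊆ ⋃ j ∈ Finset.Icc 1 N, A ∩ T^[j] ⁻¹' A := by
  rintro x ⟨hxA, hx⟩
  have hx' : sInf {ℓ : ℕ∞ | ∃ m : ℕ, ℓ = (m : ℕ∞) ∧ 1 ≤ m ∧ T^[m] x ∈ A} ≤ (N : ℕ∞) := hx
  have hne : {ℓ : ℕ∞ | ∃ m : ℕ, ℓ = (m : ℕ∞) ∧ 1 ≤ m ∧ T^[m] x ∈ A}.Nonempty := by
    by_contra h
    rw [Set.not_nonempty_iff_eq_empty] at h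
    rw [h, sInf_empty] at hx'
    simp at hx'
  obtain ⟨m, hm, h1, h2⟩ := csInf_mem hne
  rw [hm] at hx'
  have hmN : m ≤ N := by exact_mod_cast hx'
  simp only [Set.mem_iUnion, Finset.mem_Icc]
  exact ⟨m, ⟨h1, hmN⟩, hxA, h2⟩

/-- For every `n ∈ ℕ`, every `A ∈ σ(𝒜ⁿ)` with `μ(A) > 0`, and every real
`t > 0` one has `ℙ_A(τ_A ≤ t) ≤ 2n(δ_A(n) + δ_A(r_A)) + t·μ(A) + ᾱ(n)`. -/
theorem cond_prob_return_le_t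
    {Ω : Type*} [MeasurableSpace Ω] (μ : Measure Ω) [IsProbabilityMeasure μ]
    (T : Ω → Ω) (hT : MeasurePreserving T μ μ)
    (𝒜 : Set (Set Ω)) (hcnt : 𝒜.Countable) (hms : ∀ s ∈ 𝒜, MeasurableSet s)
    (hdisj : 𝒜.PairwiseDisjoint id) (hcov : ⋃₀ 𝒜 = Set.univ)
    (α : ℕ → ℝ) (hanti : Antitone α) (hα_lim : Tendsto α atTop (nhds 0)) (hα0 : α 0 = 1)
    (hsum : Summable α)
    (hmix : AlphaMixing μ T 𝒜 α) :
    ∀ n : ℕ, 1 ≤ n → ∀ A : Set Ω, IsCylinderUnion T 𝒜 n A → 0 < μ A → ∀ t : ℝ, 0 < t →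
      (μ (A ∩ {x | hitTime T A x ≤ (⌊t⌋₊ : ℕ∞)})).toReal / (μ A).toReal ≤
        2 * n * (deltaA μ T 𝒜 α A n + deltaA μ T 𝒜 α A (recTime T A)) +
          t * (μ A).toReal + alphaBar α n := by
  intro n hn A hA hpos t ht
  have hα_nn : ∀ k, 0 ≤ α k := fun k => hanti.le_of_tendsto hα_lim k
  have hδ_nn : ∀ k, 0 ≤ deltaA μ T 𝒜 α A k := by
    intro k
    apply Real.sInf_nonneg
    rintro _ ⟨w, _, rfl⟩
    exact add_nonneg ENNReal.toReal_nonneg (hα_nn _)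
  have hAm := aux_meas T 𝒜 n A hA
  set a := (μ A).toReal with ha
  have ha_pos : 0 < a := ENNReal.toReal_pos hpos.ne' (measure_ne_top _ _)
  set D := deltaA μ T 𝒜 α A (recTime T A) with hD
  have hD_nn : 0 ≤ D := hδ_nn _
  -- short returns
  have hshort : ∀ j, 1 ≤ j → (μ (A ∩ T^[j] ⁻¹' A)).toReal ≤ a * D := by
    intro j hj
    by_cases hne : (A ∩ T^[j] ⁻¹' A).Nonempty
    · have hmem : j ∈ {j : ℕ | 1 ≤ j ∧ (A ∩ T^[j] ⁻¹' A).Nonempty} := ⟨hj, hne⟩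
      have hrj : recTime T A ≤ j := Nat.sInf_le hmem
      have hr1 : 1 ≤ recTime T A := (Nat.sInf_mem ⟨j, hmem⟩).1
      have key : (μ (A ∩ T^[j] ⁻¹' A)).toReal / a ≤ D := by
        apply le_csInf
        · exact ⟨_, 1, ⟨le_refl _, hr1⟩, rfl⟩
        · rintro _ ⟨w, ⟨hw1, hw2⟩, rfl⟩
          rw [div_le_iff₀ ha_pos]
          have h1 := hmix w (j - w) _ A (aux_hull_union T 𝒜 hcnt w A) hAm
          rw [show w + (j - w) = j by omega] at h1
          have h2 := (abs_le.mp h1).2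
          have h3 : (μ (A ∩ T^[j] ⁻¹' A)).toReal
              ≤ (μ (cylinderHull T 𝒜 w A ∩ T^[j] ⁻¹' A)).toReal :=
            ENNReal.toReal_mono (measure_ne_top _ _)
              (measure_mono (Set.inter_subset_inter_left _ (aux_subset_hull T 𝒜 hcov w A)))
          have h4 : α (j - w) ≤ α (recTime T A - w) := hanti (by omega)
          have h5 := mul_le_mul_of_nonneg_right h4 ha_pos.le
          simp only [add_mul]
          linarith
      rw [div_le_iff₀ ha_pos] at key
      linarith
    · rw [Set.not_nonempty_iff_eq_empty.mp hne]
      simp only [measure_empty, ENNReal.toReal_zero]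
      positivity
  have hlong : ∀ j, n ≤ j → (μ (A ∩ T^[j] ⁻¹' A)).toReal ≤ a * (α (j - n) + a) := by
    intro j hj
    have h1 := hmix n (j - n) A A hA hAm
    rw [show n + (j - n) = j by omega] at h1
    have h2 := (abs_le.mp h1).2
    rw [← ha] at h2
    linarith
  set f : ℕ → ℝ := fun j => if j < 2 * n then D else α (j - n) with hf
  have hf_nn : ∀ j, 0 ≤ f j := by
    intro j
    simp only [hf]
    split_ifs
    · exact hD_nn
    · exact hα_nn _
  have hterm : ∀ j, 1 ≤ j → (μ (A ∩ T^[j] ⁻¹' A)).toReal ≤ a * (f j + a) := by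
    intro j hj
    simp only [hf]
    split_ifs with h
    · have := hshort j hj
      nlinarith
    · exact hlong j (by omega)
  set N := ⌊t⌋₊ with hN
  have hNt : (N : ℝ) ≤ t := Nat.floor_le ht.le
  have hsumf : ∑ j ∈ Finset.Icc 1 N, f j ≤ 2 * n * D + alphaBar α n := by
    calc ∑ j ∈ Finset.Icc 1 N, f j ≤ ∑ j ∈ Finset.range (2 * n + N), f j := by
          apply Finset.sum_le_sum_of_subset_of_nonneg
          · intro j hj
            simp only [Finset.mem_Icc, Finset.mem_range] at *
            omega
          · exact fun j _ _ => hf_nn j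
      _ = ∑ j ∈ Finset.range (2 * n), f j + ∑ j ∈ Finset.range N, f (2 * n + j) :=
          Finset.sum_range_add _ _ _
      _ = 2 * n * D + ∑ j ∈ Finset.range N, α (n + j) := by
          congr 1
          · rw [Finset.sum_congr rfl (g := fun _ => D)]
            · simp
            · intro j hj
              simp only [hf, if_pos (Finset.mem_range.mp hj)]
          · apply Finset.sum_congr rfl
            intro j _
            simp only [hf]
            rw [if_neg (by omega)]
            congr 1
            omega
      _ ≤ 2 * n * D + alphaBar α n := by
          have : Summable (fun j => α (n + j)) := by
            simpa [add_comm] using (summable_nat_add_iff n).mpr hsum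
          have := this.sum_le_tsum (Finset.range N) (fun j _ => hα_nn _)
          unfold alphaBar
          linarith
  have hmain : (μ (A ∩ {x | hitTime T A x ≤ (N : ℕ∞)})).toReal
      ≤ ∑ j ∈ Finset.Icc 1 N, a * (f j + a) := by
    calc (μ (A ∩ {x | hitTime T A x ≤ (N : ℕ∞)})).toReal
        ≤ (∑ j ∈ Finset.Icc 1 N, μ (A ∩ T^[j] ⁻¹' A)).toReal :=
          ENNReal.toReal_mono (ENNReal.sum_ne_top.mpr fun _ _ => measure_ne_top _ _)
            ((measure_mono (aux_hit T A N)).trans (measure_biUnion_finset_le _ _))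
      _ = ∑ j ∈ Finset.Icc 1 N, (μ (A ∩ T^[j] ⁻¹' A)).toReal :=
          ENNReal.toReal_sum fun _ _ => measure_ne_top _ _
      _ ≤ _ := Finset.sum_le_sum fun j hj => hterm j (Finset.mem_Icc.mp hj).1
  rw [div_le_iff₀ ha_pos]
  refine hmain.trans ?_
  rw [← Finset.mul_sum, Finset.sum_add_distrib, mul_comm]
  apply mul_le_mul_of_nonneg_right _ ha_pos.le
  have h6 : ∑ j ∈ Finset.Icc 1 N, a = N * a := by simp
  rw [h6]
  have h7 : (N : ℝ) * a ≤ t * a := mul_le_mul_of_nonneg_right hNt ha_pos.le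
  have h8 : 0 ≤ 2 * (n : ℝ) * deltaA μ T 𝒜 α A n :=
    mul_nonneg (by positivity) (hδ_nn n)
  rw [mul_add]
  linarith
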